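/- arXiv:2110.00951 — 2 statements merged into one kernel-verified Lean document; each statement's English description precedes it below -/
import Mathlib

section
/- Let d ≥ 0, let g : ℝ^{d+1} → ℝ, let K ≥ 0 and θ₁ ∈ (0,1], and set q = 2^{-θ₁}. Suppose that for every integer n ≥ 1 and every j ∈ ℤ^{d+1} the oscillation of g on the closed cube 2^{-n} j + [0, 2^{-n}]^{d+1} is at most K q^n. Then for every y ∈ ℝ^{d+1} and every Δ ∈ ℝ^{d+1} with 0 < ‖Δ‖_∞ ≤ 1/2 one has |g(y + Δ) - g(y)| ≤ 4 K ‖Δ‖_∞^{θ₁}. -/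
/-- Hölder-continuity consequence of Lemma 4: dyadic oscillation bounds
`K q^n` with `q = 2^{-θ₁}` imply `|g (y + Δ) - g y| ≤ 4 K ‖Δ‖∞^{θ₁}`
for `0 < ‖Δ‖∞ ≤ 1/2`. -/
theorem stmt_2 (d : ℕ) (g : (Fin (d + 1) → ℝ) → ℝ) (K : ℝ) (hK : 0 ≤ K)
    (θ₁ : ℝ) (hθ₁0 : 0 < θ₁) (hθ₁1 : θ₁ ≤ 1)
    (hosc : ∀ n : ℕ, 1 ≤ n → ∀ j : Fin (d + 1) → ℤ,
      ∀ z₁ z₂ : Fin (d + 1) → ℝ,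
        (∀ i, (j i : ℝ) * 2⁻¹ ^ n ≤ z₁ i ∧ z₁ i ≤ (j i : ℝ) * 2⁻¹ ^ n + 2⁻¹ ^ n) →
        (∀ i, (j i : ℝ) * 2⁻¹ ^ n ≤ z₂ i ∧ z₂ i ≤ (j i : ℝ) * 2⁻¹ ^ n + 2⁻¹ ^ n) →
        g z₁ - g z₂ ≤ K * ((2 : ℝ) ^ (-θ₁)) ^ n) :
    ∀ y Δ : Fin (d + 1) → ℝ, 0 < ‖Δ‖ → ‖Δ‖ ≤ 1 / 2 →
      |g (y + Δ) - g y| ≤ 4 * K * ‖Δ‖ ^ θ₁ := by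
  intro y Δ hΔ hΔ2
  obtain ⟨n, hn1, hn2⟩ := exists_nat_pow_near_of_lt_one (x := ‖Δ‖) (y := (2⁻¹ : ℝ)) hΔ
    (by linarith) (by norm_num) (by norm_num)
  have hn : 1 ≤ n := by
    rcases Nat.eq_zero_or_pos n with h | h
    · subst h
      norm_num at hn1
      linarith
    · exact h
  have hp : (0 : ℝ) < 2⁻¹ ^ n := by positivity
  set p : ℝ := 2⁻¹ ^ n with hpdef
  have key : ∀ x : ℝ, (⌊x / p⌋ : ℝ) * p ≤ x ∧ x < (⌊x / p⌋ : ℝ) * p + p := by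
    intro x
    have h1 := Int.floor_le (x / p)
    have h2 := Int.lt_floor_add_one (x / p)
    rw [le_div_iff₀ hp] at h1
    rw [div_lt_iff₀ hp] at h2
    exact ⟨h1, by linarith⟩
  have hnear : ∀ x x' : ℝ, x' - x ≤ p → ⌊x' / p⌋ ≤ ⌊x / p⌋ + 1 := by
    intro x x' h
    have h1 : x' / p ≤ x / p + 1 := by
      rw [div_add_one hp.ne']
      gcongr
      linarith
    calc ⌊x' / p⌋ ≤ ⌊x / p + 1⌋ := Int.floor_le_floor h1
      _ = ⌊x / p⌋ + 1 := Int.floor_add_one _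
  have hco : ∀ i, |Δ i| ≤ p := fun i => by
    have := norm_le_pi_norm Δ i
    rw [Real.norm_eq_abs] at this
    linarith
  set z := y + Δ with hz
  set a : Fin (d + 1) → ℤ := fun i => ⌊y i / p⌋ with ha
  set b : Fin (d + 1) → ℤ := fun i => ⌊z i / p⌋ with hb
  set w : Fin (d + 1) → ℝ := fun i => ((max (a i) (b i) : ℤ) : ℝ) * p with hw
  have hcube : ∀ k m : ℤ, k ≤ m → m ≤ k + 1 → (k : ℝ) * p ≤ (m : ℝ) * p ∧
      (m : ℝ) * p ≤ (k : ℝ) * p + p := by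
    intro k m h1 h2
    have h1' : (k : ℝ) ≤ m := by exact_mod_cast h1
    have h2' : (m : ℝ) ≤ k + 1 := by exact_mod_cast h2
    constructor <;> nlinarith
  have hba : ∀ i, b i ≤ a i + 1 := fun i => hnear _ _ (by
    have := (abs_le.1 (hco i)).2
    simp only [hz, Pi.add_apply]; linarith)
  have hab : ∀ i, a i ≤ b i + 1 := fun i => hnear _ _ (by
    have := (abs_le.1 (hco i)).1
    simp only [hz, Pi.add_apply]; linarith)
  have hwa : ∀ i, (a i : ℝ) * p ≤ w i ∧ w i ≤ (a i : ℝ) * p + p := fun i =>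
    hcube _ _ (le_max_left _ _) (max_le (by lia) (hba i))
  have hwb : ∀ i, (b i : ℝ) * p ≤ w i ∧ w i ≤ (b i : ℝ) * p + p := fun i =>
    hcube _ _ (le_max_right _ _) (max_le (hab i) (by lia))
  have hya : ∀ i, (a i : ℝ) * p ≤ y i ∧ y i ≤ (a i : ℝ) * p + p := fun i =>
    ⟨(key (y i)).1, (key (y i)).2.le⟩
  have hzb : ∀ i, (b i : ℝ) * p ≤ z i ∧ z i ≤ (b i : ℝ) * p + p := fun i =>
    ⟨(key (z i)).1, (key (z i)).2.le⟩
  have e1 := hosc n hn a y w hya hwa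
  have e2 := hosc n hn a w y hwa hya
  have e3 := hosc n hn b z w hzb hwb
  have e4 := hosc n hn b w z hwb hzb
  have hq : ((2 : ℝ) ^ (-θ₁)) ^ n ≤ 2 * ‖Δ‖ ^ θ₁ := by
    have h1 : ((2 : ℝ) ^ (-θ₁)) ^ n = p ^ θ₁ := by
      rw [Real.rpow_neg (by norm_num), ← Real.inv_rpow (by norm_num), hpdef,
        Real.rpow_pow_comm (by norm_num)]
    have h2 : p ≤ 2 * ‖Δ‖ := by
      rw [pow_succ] at hn1
      linarith
    have h3 : (2 : ℝ) ^ θ₁ ≤ 2 := by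
      simpa using Real.rpow_le_rpow_of_exponent_le (x := 2) (by norm_num) hθ₁1
    rw [h1]
    calc p ^ θ₁ ≤ (2 * ‖Δ‖) ^ θ₁ := Real.rpow_le_rpow hp.le h2 hθ₁0.le
      _ = 2 ^ θ₁ * ‖Δ‖ ^ θ₁ := Real.mul_rpow (by norm_num) hΔ.le
      _ ≤ 2 * ‖Δ‖ ^ θ₁ := by gcongr
  have hKq := mul_le_mul_of_nonneg_left hq hK
  rw [abs_le]
  constructor <;> linarith
end

section
/- Let d ≥ 1, let u : [0,1]^d → ℝ be continuous with u(0) = 0, and let K ≥ 0 and q ∈ (0,1). Suppose that for every integer n ≥ 1 and all k, e ∈ ℤ^d with ‖e‖_∞ ≤ 1 such that both k 2^{-n} and (k+e) 2^{-n} lie in [0,1]^d, one has |u((k+e) 2^{-n}) - u(k 2^{-n})| ≤ K q^n. Then sup_{x ∈ [0,1]^d} |u(x)| ≤ K q / (1 - q). -/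
lemma dyadic_coord (t : ℝ) (h0 : 0 ≤ t) (h1 : t ≤ 1) : ∃ k : ℕ → ℤ, k 0 = 0 ∧
    (∀ n, |k (n+1) - 2 * k n| ≤ 1) ∧ (∀ n, 0 ≤ k n) ∧
    (∀ n, (k n : ℝ) ≤ t * 2 ^ n) ∧ (∀ n, t * 2 ^ n ≤ k n + 1) := by
  rcases h1.eq_or_lt with rfl | h1
  · refine ⟨fun n => 2 ^ n - 1, by simp, fun n => ?_, fun n => ?_, fun n => ?_, fun n => ?_⟩
    · have : (2 : ℤ) ^ (n+1) - 1 - 2 * (2 ^ n - 1) = 1 := by ring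
      simp [this]
    · have : (1 : ℤ) ≤ 2 ^ n := one_le_pow₀ (by norm_num)
      simpa using this
    · simp
    · simp
  · refine ⟨fun n => ⌊t * 2 ^ n⌋, ?_, fun n => ?_, fun n => ?_, fun n => ?_, fun n => ?_⟩
    · simp only [pow_zero, mul_one]
      exact Int.floor_eq_zero_iff.2 ⟨h0, h1⟩
    · have a1 := Int.floor_le (t * 2 ^ n)
      have a2 := Int.lt_floor_add_one (t * 2 ^ n)
      have b1 := Int.floor_le (t * 2 ^ (n+1))
      have b2 := Int.lt_floor_add_one (t * 2 ^ (n+1))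
      have e : t * 2 ^ (n+1) = 2 * (t * 2 ^ n) := by ring
      have c1 : 2 * ⌊t * 2 ^ n⌋ < ⌊t * 2 ^ (n+1)⌋ + 1 := by
        have : (2 * ⌊t * 2 ^ n⌋ : ℝ) < ⌊t * 2 ^ (n+1)⌋ + 1 := by linarith
        exact_mod_cast this
      have c2 : ⌊t * 2 ^ (n+1)⌋ < 2 * ⌊t * 2 ^ n⌋ + 2 := by
        have : (⌊t * 2 ^ (n+1)⌋ : ℝ) < 2 * ⌊t * 2 ^ n⌋ + 2 := by linarith
        exact_mod_cast this
      simp only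
      rw [abs_le]
      constructor <;> omega
    · exact Int.floor_nonneg.2 (by positivity)
    · exact Int.floor_le _
    · exact (Int.lt_floor_add_one _).le

/-- Telescoping estimate (inequality (31)) in the proof of Lemma 3: if the
increments of `u` between neighbouring dyadic grid points in `[0,1]^d` are
bounded by `K q^n`, then `sup_{[0,1]^d} |u| ≤ K q / (1 - q)`. -/
theorem stmt_3 (d : ℕ) (hd : 1 ≤ d) (u : (Fin d → ℝ) → ℝ)
    (hcont : ContinuousOn u (Set.Icc (0 : Fin d → ℝ) 1)) (hu0 : u 0 = 0)
    (K q : ℝ) (hK : 0 ≤ K) (hq0 : 0 < q) (hq1 : q < 1)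
    (hinc : ∀ n : ℕ, 1 ≤ n → ∀ k e : Fin d → ℤ, (∀ i, |e i| ≤ 1) →
      (fun i => (k i : ℝ) * 2⁻¹ ^ n) ∈ Set.Icc (0 : Fin d → ℝ) 1 →
      (fun i => ((k i : ℝ) + (e i : ℝ)) * 2⁻¹ ^ n) ∈ Set.Icc (0 : Fin d → ℝ) 1 →
      |u (fun i => ((k i : ℝ) + (e i : ℝ)) * 2⁻¹ ^ n) - u (fun i => (k i : ℝ) * 2⁻¹ ^ n)|
        ≤ K * q ^ n) :
    ∀ x ∈ Set.Icc (0 : Fin d → ℝ) 1, |u x| ≤ K * q / (1 - q) := by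
  intro x hx
  choose k k0 kd kn kl ku using fun i => dyadic_coord (x i) (hx.1 i) (hx.2 i)
  set p : ℕ → Fin d → ℝ := fun n i => (k i n : ℝ) * 2⁻¹ ^ n with hp
  have inv : ∀ n : ℕ, (2 : ℝ) ^ n * 2⁻¹ ^ n = 1 := fun n => by
    rw [← mul_pow]; norm_num
  have pos : ∀ n : ℕ, (0 : ℝ) < 2⁻¹ ^ n := fun n => by positivity
  have ple : ∀ n i, p n i ≤ x i := fun n i => by
    have := mul_le_mul_of_nonneg_right (kl i n) (pos n).le
    rwa [mul_assoc, inv, mul_one] at this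
  have pge : ∀ n i, x i - 2⁻¹ ^ n ≤ p n i := fun n i => by
    have := mul_le_mul_of_nonneg_right (ku i n) (pos n).le
    rw [mul_assoc, inv, mul_one, add_mul, one_mul] at this
    simp only [hp]
    linarith
  have pmem : ∀ n, p n ∈ Set.Icc (0 : Fin d → ℝ) 1 := fun n => by
    refine ⟨fun i => ?_, fun i => (ple n i).trans (hx.2 i)⟩
    have h : (0 : ℝ) ≤ (k i n : ℝ) := by exact_mod_cast kn i n
    exact mul_nonneg h (pos n).le
  have step : ∀ n, |u (p (n+1)) - u (p n)| ≤ K * q ^ (n+1) := fun n => by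
    have h := hinc (n+1) (by omega) (fun i => 2 * k i n) (fun i => k i (n+1) - 2 * k i n)
      (fun i => kd i n)
    have e1 : (fun i => (((2 * k i n : ℤ) : ℝ)) * 2⁻¹ ^ (n+1)) = p n := by
      funext i
      simp only [hp]
      push_cast
      ring
    have e2 : (fun i => (((2 * k i n : ℤ) : ℝ) + ((k i (n+1) - 2 * k i n : ℤ) : ℝ))
        * 2⁻¹ ^ (n+1)) = p (n+1) := by
      funext i
      simp only [hp]
      push_cast
      ring
    simp only [e1, e2] at h
    exact h (pmem n) (pmem (n+1))
  have q1 : 0 < 1 - q := by linarith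
  have bound : ∀ n, |u (p n)| ≤ K * q / (1 - q) * (1 - q ^ n) := by
    intro n
    induction n with
    | zero =>
      have : p 0 = 0 := by funext i; simp [hp, k0]
      simp [this, hu0]
    | succ n ih =>
      have h1 := abs_sub_abs_le_abs_sub (u (p (n+1))) (u (p n))
      have h2 := step n
      have e : K * q / (1 - q) * (1 - q ^ (n+1))
          = K * q / (1 - q) * (1 - q ^ n) + K * q ^ (n+1) := by
        field_simp
        ring
      linarith
  have bound2 : ∀ n, |u (p n)| ≤ K * q / (1 - q) := fun n => by
    refine (bound n).trans (mul_le_of_le_one_right (by positivity) ?_)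
    have : 0 < q ^ n := by positivity
    linarith
  have lim : Filter.Tendsto p Filter.atTop (nhds x) := by
    rw [tendsto_pi_nhds]
    intro i
    have z : Filter.Tendsto (fun n : ℕ => x i - (2⁻¹ : ℝ) ^ n) Filter.atTop (nhds (x i)) := by
      simpa using (tendsto_pow_atTop_nhds_zero_of_lt_one (r := (2⁻¹ : ℝ))
        (by norm_num) (by norm_num)).const_sub (x i)
    exact tendsto_of_tendsto_of_tendsto_of_le_of_le z tendsto_const_nhds
      (fun n => pge n i) (fun n => ple n i)
  have lim2 : Filter.Tendsto (fun n => u (p n)) Filter.atTop (nhds (u x)) :=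
    (hcont x hx).tendsto.comp
      (tendsto_nhdsWithin_iff.2 ⟨lim, Filter.Eventually.of_forall pmem⟩)
  exact le_of_tendsto lim2.abs (Filter.Eventually.of_forall bound2)
end
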